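/- Let Q and P be concatenations on the same set X, with associated metrics d_Q and d_P. Then the coverings Q and P are equivalent if and only if the identity map Id_X : (X,d_Q) → (X,d_P) is a quasi-isometry. -/

import Mathlib

open Set Pointwise MeasureTheory
open scoped Classical

/-- A `Q`-chain of length `k` from `x` to `y`: a sequence `Q_{i₁}, …, Q_{i_k}` of members of the
covering with `x ∈ Q_{i₁}`, `y ∈ Q_{i_k}` and consecutive members intersecting. -/
def ChainExists {X I : Type*} (Q : I → Set X) (k : ℕ) (x y : X) : Prop :=
  ∃ (hk : 0 < k) (c : Fin k → I),
    x ∈ Q (c ⟨0, hk⟩) ∧ y ∈ Q (c ⟨k - 1, Nat.sub_lt hk Nat.one_pos⟩) ∧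
      ∀ (l : ℕ) (h : l + 1 < k),
        (Q (c ⟨l, by omega⟩) ∩ Q (c ⟨l + 1, h⟩)).Nonempty

/-- An admissible covering: a family of nonempty sets covering `X` such that the number of
neighbours of each member is uniformly bounded. -/
def IsAdmissibleCovering {X I : Type*} (Q : I → Set X) : Prop :=
  (∀ i, (Q i).Nonempty) ∧ (⋃ i, Q i) = Set.univ ∧
    ∃ N : ℕ, ∀ i, {j | (Q i ∩ Q j).Nonempty}.Finite ∧ {j | (Q i ∩ Q j).Nonempty}.ncard ≤ N

/-- A concatenation: an admissible covering in which any two points are joined by a chain. -/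
def IsConcatenation {X I : Type*} (Q : I → Set X) : Prop :=
  IsAdmissibleCovering Q ∧ ∀ x y : X, ∃ k : ℕ, ChainExists Q k x y

/-- The associated metric `d_Q` of a covered space `(X, Q)`. -/
noncomputable def coveredDist {X I : Type*} (Q : I → Set X) (x y : X) : ℝ :=
  if x = y then 0 else ((sInf {k : ℕ | ChainExists Q k x y} : ℕ) : ℝ)

/-- Quasi-isometric embedding between (abstract) metric spaces. -/
def IsQIEmbedding {X Z : Type*} (dX : X → X → ℝ) (dZ : Z → Z → ℝ) (f : X → Z) : Prop :=
  ∃ L C : ℝ, 0 < L ∧ 0 < C ∧ ∀ x y : X,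
    (1 / L) * dX x y - C ≤ dZ (f x) (f y) ∧ dZ (f x) (f y) ≤ L * dX x y + C

/-- Quasi-isometry: a quasi-isometric embedding whose image is a net. -/
def IsQuasiIsometry {X Z : Type*} (dX : X → X → ℝ) (dZ : Z → Z → ℝ) (f : X → Z) : Prop :=
  IsQIEmbedding dX dZ f ∧ ∃ M : ℝ, 0 < M ∧ ∀ z : Z, ∃ x : X, dZ z (f x) ≤ M

/-- The iterated neighbourhood `P_j^{k*}` of a member of a covering. -/
def starSet {X J : Type*} (P : J → Set X) (j : J) : ℕ → Set X
  | 0 => P j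
  | k + 1 => ⋃ l ∈ {l | (P l ∩ starSet P j k).Nonempty}, P l

/-- `Q` is almost subordinate to `P`. -/
def AlmostSubordinate {X I J : Type*} (Q : I → Set X) (P : J → Set X) : Prop :=
  ∃ k : ℕ, ∀ i : I, ∃ j : J, Q i ⊆ starSet P j k

/-- Two coverings of the same set are equivalent if each is almost subordinate to the other. -/
def EquivalentCoverings {X I J : Type*} (Q : I → Set X) (P : J → Set X) : Prop :=
  AlmostSubordinate Q P ∧ AlmostSubordinate P Q

/-- The word metric associated to a generating set `S` of a group. -/
noncomputable def wordDist {G : Type*} [Group G] (S : Set G) (g h : G) : ℝ :=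
  ((sInf {n : ℕ | ∃ w : Fin n → G, (∀ i, w i ∈ S) ∧ g⁻¹ * h = (List.ofFn w).prod} : ℕ) : ℝ)

section CoveredSpace

variable {X I J : Type*} {Q : I → Set X} {P : J → Set X} {x y z : X}

theorem IsAdmissibleCovering.exists_mem (hQ : IsAdmissibleCovering Q) (x : X) : ∃ i, x ∈ Q i :=
  mem_iUnion.mp (hQ.2.1 ▸ mem_univ x)

theorem chainExists_one : ChainExists Q 1 x y ↔ ∃ i, x ∈ Q i ∧ y ∈ Q i := by
  constructor
  · rintro ⟨_, c, hx, hy, _⟩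
    exact ⟨_, hx, hy⟩
  · rintro ⟨i, hx, hy⟩
    exact ⟨one_pos, fun _ => i, hx, hy, fun l h => by omega⟩

theorem chainExists_succ {k : ℕ} (hk : 0 < k) :
    ChainExists Q (k + 1) x y ↔ ∃ z i, ChainExists Q k x z ∧ z ∈ Q i ∧ y ∈ Q i := by
  constructor
  · rintro ⟨_, c, hx, hy, hc⟩
    obtain ⟨m, rfl⟩ : ∃ m, k = m + 1 := ⟨k - 1, by omega⟩
    obtain ⟨z, hz, hz'⟩ := hc m (by omega)
    exact ⟨z, _, ⟨hk, fun l => c l.castSucc, hx, hz, fun l h => hc l (by omega)⟩, hz', hy⟩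
  · rintro ⟨z, i, ⟨_, c, hx, hz, hc⟩, hzi, hyi⟩
    refine ⟨k.succ_pos, fun l => if h : l.1 < k then c ⟨l.1, h⟩ else i, ?_, ?_, fun l h => ?_⟩
    · simpa [hk] using hx
    · simpa using hyi
    · have hl : l < k := by omega
      by_cases hl' : l + 1 < k
      · simpa [hl, hl'] using hc l hl'
      · obtain rfl : l = k - 1 := by omega
        simp only [hl, hl', dite_true, dite_false]
        exact ⟨z, hz, hzi⟩

theorem ChainExists.pos {k : ℕ} (h : ChainExists Q k x y) : 0 < k := h.1

theorem ChainExists.trans {m n : ℕ} (hxy : ChainExists Q m x y) (hyz : ChainExists Q n y z) :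
    ChainExists Q (m + n) x z := by
  induction n, hyz.pos using Nat.le_induction generalizing z with
  | base =>
    obtain ⟨i, hy, hz⟩ := chainExists_one.mp hyz
    exact (chainExists_succ hxy.pos).mpr ⟨y, i, hxy, hy, hz⟩
  | succ n hn ih =>
    obtain ⟨w, i, hw, hwi, hzi⟩ := (chainExists_succ hn).mp hyz
    exact (chainExists_succ (m.add_pos_left hxy.pos n)).mpr ⟨w, i, ih hw, hwi, hzi⟩

theorem ChainExists.symm {n : ℕ} (h : ChainExists Q n x y) : ChainExists Q n y x := by
  induction n, h.pos using Nat.le_induction generalizing y with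
  | base =>
    obtain ⟨i, hx, hy⟩ := chainExists_one.mp h
    exact chainExists_one.mpr ⟨i, hy, hx⟩
  | succ n hn ih =>
    obtain ⟨z, i, hz, hzi, hyi⟩ := (chainExists_succ hn).mp h
    rw [add_comm]
    exact (chainExists_one.mpr ⟨i, hyi, hzi⟩).trans (ih hz)

theorem ChainExists.mono (hQ : IsAdmissibleCovering Q) {m n : ℕ} (hmn : m ≤ n)
    (h : ChainExists Q m x y) : ChainExists Q n x y := by
  induction n, hmn using Nat.le_induction with
  | base => exact h
  | succ n hn ih =>
    obtain ⟨i, hi⟩ := hQ.exists_mem y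
    exact ih.trans (chainExists_one.mpr ⟨i, hi, hi⟩)

theorem ChainExists.mem_starSet {n : ℕ} (h : ChainExists Q n x y) {i : I} (hx : x ∈ Q i) :
    y ∈ starSet Q i n := by
  induction n, h.pos using Nat.le_induction generalizing y with
  | base =>
    obtain ⟨l, hxl, hyl⟩ := chainExists_one.mp h
    exact mem_biUnion (show l ∈ {l | (Q l ∩ Q i).Nonempty} from ⟨x, hxl, hx⟩) hyl
  | succ n hn ih =>
    obtain ⟨z, l, hz, hzl, hyl⟩ := (chainExists_succ hn).mp h
    exact mem_biUnion (show l ∈ {l | (Q l ∩ starSet Q i n).Nonempty} from ⟨z, hzl, ih hz⟩) hyl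

theorem chainExists_of_mem_starSet {n : ℕ} {i : I} (hx : x ∈ Q i) (hy : y ∈ starSet Q i n) :
    ChainExists Q (n + 1) x y := by
  induction n generalizing y with
  | zero => exact chainExists_one.mpr ⟨i, hx, hy⟩
  | succ n ih =>
    obtain ⟨l, ⟨z, hzl, hz⟩, hyl⟩ := mem_iUnion₂.mp hy
    exact (chainExists_succ n.succ_pos).mpr ⟨z, l, ih hz, hzl, hyl⟩

/-- If any two points of a common member of `Q` are joined by a `P`-chain of length `m`, then
`Q`-chains of length `n` can be refined to `P`-chains of length `m * n`. -/
theorem ChainExists.refine {m n : ℕ} (hm : ∀ i, ∀ a ∈ Q i, ∀ b ∈ Q i, ChainExists P m a b)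
    (h : ChainExists Q n x y) : ChainExists P (m * n) x y := by
  induction n, h.pos using Nat.le_induction generalizing y with
  | base =>
    obtain ⟨i, hx, hy⟩ := chainExists_one.mp h
    simpa using hm i x hx y hy
  | succ n hn ih =>
    obtain ⟨z, i, hz, hzi, hyi⟩ := (chainExists_succ hn).mp h
    exact (ih hz).trans (hm i z hzi y hyi)

theorem ChainExists.coveredDist_le {n : ℕ} (h : ChainExists Q n x y) :
    coveredDist Q x y ≤ n := by
  unfold coveredDist
  split_ifs
  · positivity
  · exact_mod_cast Nat.sInf_le h

theorem IsConcatenation.chainExists (hQ : IsConcatenation Q) {n : ℕ} (hn : 0 < n)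
    (h : coveredDist Q x y ≤ n) : ChainExists Q n x y := by
  by_cases hxy : x = y
  · subst hxy
    obtain ⟨i, hi⟩ := hQ.1.exists_mem x
    exact (chainExists_one.mpr ⟨i, hi, hi⟩).mono hQ.1 hn
  · rw [coveredDist, if_neg hxy] at h
    exact ChainExists.mono hQ.1 (by exact_mod_cast h) (Nat.sInf_mem (hQ.2 x y))

theorem coveredDist_nonneg : 0 ≤ coveredDist Q x y := by
  unfold coveredDist
  split_ifs <;> positivity

theorem IsConcatenation.coveredDist_le_mul (hQ : IsConcatenation Q) {m : ℕ}
    (hm : ∀ i, ∀ a ∈ Q i, ∀ b ∈ Q i, ChainExists P m a b) (x y : X) :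
    coveredDist P x y ≤ m * coveredDist Q x y := by
  by_cases hxy : x = y
  · simp [coveredDist, hxy]
  · have h := (ChainExists.refine hm (Nat.sInf_mem (hQ.2 x y))).coveredDist_le
    rw [Nat.cast_mul] at h
    rwa [coveredDist.eq_1 Q, if_neg hxy]

/-- Almost subordination means that the members of `Q` have uniformly bounded `P`-diameter. -/
theorem almostSubordinate_iff_exists_chainExists (hQ : IsAdmissibleCovering Q)
    (hP : IsAdmissibleCovering P) :
    AlmostSubordinate Q P ↔
      ∃ m, 0 < m ∧ ∀ i, ∀ a ∈ Q i, ∀ b ∈ Q i, ChainExists P m a b := by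
  constructor
  · rintro ⟨k, hk⟩
    refine ⟨(k + 1) + (k + 1), by omega, fun i a ha b hb => ?_⟩
    obtain ⟨j, hj⟩ := hk i
    obtain ⟨x, hx⟩ := hP.1 j
    exact (chainExists_of_mem_starSet hx (hj ha)).symm.trans
      (chainExists_of_mem_starSet hx (hj hb))
  · rintro ⟨m, -, hm⟩
    refine ⟨m, fun i => ?_⟩
    obtain ⟨x, hx⟩ := hQ.1 i
    obtain ⟨j, hj⟩ := hP.exists_mem x
    exact ⟨j, fun y hy => (hm i x hx y hy).mem_starSet hj⟩

theorem almostSubordinate_of_coveredDist_le (hQ : IsAdmissibleCovering Q)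
    (hP : IsConcatenation P) {A B : ℝ} (hA : 0 ≤ A)
    (h : ∀ x y, coveredDist P x y ≤ A * coveredDist Q x y + B) : AlmostSubordinate Q P := by
  rw [almostSubordinate_iff_exists_chainExists hQ hP.1]
  obtain ⟨n, hn⟩ := exists_nat_ge (A + B)
  refine ⟨n + 1, n.succ_pos, fun i a ha b hb => hP.chainExists n.succ_pos ?_⟩
  have hab : coveredDist Q a b ≤ (1 : ℕ) := (chainExists_one.mpr ⟨i, ha, hb⟩).coveredDist_le
  have hAab := mul_le_mul_of_nonneg_left hab hA
  push_cast at hAab ⊢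
  linarith [h a b]

end CoveredSpace

/-- Let `Q` and `P` be concatenations on the same set `X`, with associated
metrics `d_Q` and `d_P`. Then the coverings `Q` and `P` are equivalent if and only if the
identity map `Id_X : (X,d_Q) → (X,d_P)` is a quasi-isometry. -/
theorem statement2 {X I J : Type*} (Q : I → Set X) (P : J → Set X)
    (hQ : IsConcatenation Q) (hP : IsConcatenation P) :
    EquivalentCoverings Q P ↔
      IsQuasiIsometry (coveredDist Q) (coveredDist P) (id : X → X) := by
  constructor
  · rintro ⟨hQP, hPQ⟩
    obtain ⟨m, hm₀, hm⟩ := (almostSubordinate_iff_exists_chainExists hQ.1 hP.1).mp hQP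
    obtain ⟨n, -, hn⟩ := (almostSubordinate_iff_exists_chainExists hP.1 hQ.1).mp hPQ
    have hL : (0 : ℝ) < m + n := by positivity
    refine ⟨⟨m + n, 1, hL, one_pos, fun x y => ⟨?_, ?_⟩⟩, 1, one_pos, fun z => ⟨z, ?_⟩⟩
    · have h := hP.coveredDist_le_mul hn x y
      have hle : 1 / ((m : ℝ) + n) * coveredDist Q x y ≤ coveredDist P x y := by
        rw [one_div_mul_eq_div, div_le_iff₀ hL]
        nlinarith [mul_nonneg m.cast_nonneg (coveredDist_nonneg (Q := P) (x := x) (y := y))]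
      simp only [id]
      linarith
    · have h := hQ.coveredDist_le_mul hm x y
      have hn₀ := mul_nonneg n.cast_nonneg (coveredDist_nonneg (Q := Q) (x := x) (y := y))
      simp only [id]
      linarith
    · simp [coveredDist]
  · rintro ⟨⟨L, C, hL, -, h⟩, -⟩
    refine ⟨almostSubordinate_of_coveredDist_le hQ.1 hP hL.le fun x y => (h x y).2,
      almostSubordinate_of_coveredDist_le hP.1 hQ (B := L * C) hL.le fun x y => ?_⟩
    have hxy := (h x y).1
    rw [one_div_mul_eq_div, sub_le_iff_le_add, div_le_iff₀ hL] at hxy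
    simp only [id] at hxy
    linarith
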